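/- Let G be a finite group, k the minimal degree of a nontrivial complex irreducible character of G, and A, B, C subsets of G. If η > 0 satisfies |A||B||C| > |G|³/(η²k), then (1−η)·|C|/|G| < Prob(A,B,C) < (1+η)·|C|/|G|, where Prob(A,B,C) is the probability that ab ∈ C for uniformly random a ∈ A, b ∈ B. -/

import Mathlib

open Finset

/-- `Ncard X Y Z` is the number of pairs `(x,y) ∈ X × Y` with `x * y ∈ Z`. -/
def Ncard {G : Type} [Group G] [DecidableEq G] (X Y Z : Finset G) : ℕ :=
  ((X ×ˢ Y).filter (fun p => p.1 * p.2 ∈ Z)).card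

/-- `prob X Y Z = Ncard X Y Z / (|X| * |Y|)`. -/
noncomputable def prob {G : Type} [Group G] [DecidableEq G] (X Y Z : Finset G) : ℝ :=
  (Ncard X Y Z : ℝ) / ((X.card : ℝ) * (Y.card : ℝ))

/-- The set of complex irreducible characters of `G`. -/
def IrrChar (G : Type) [Group G] : Set (G → ℂ) :=
  {f | ∃ V : FDRep ℂ G, CategoryTheory.Simple V ∧ f = V.character}

/-- A nonzero subrepresentation of a finite-dimensional representation contains an irreducible
one. -/
theorem Subrepresentation.exists_le_isIrreducible {G V : Type*} [Group G] [AddCommGroup V]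
    [Module ℂ V] [FiniteDimensional ℂ V] {ρ : Representation ℂ G V} (E : Subrepresentation ρ)
    (hE : E.toSubmodule ≠ ⊥) :
    ∃ σ : Subrepresentation ρ, σ.toSubmodule ≤ E.toSubmodule ∧
      σ.toRepresentation.IsIrreducible := by
  obtain ⟨W, ⟨hWE, hW0, hWinv⟩, hmin⟩ := wellFounded_lt.has_min
    {W : Submodule ℂ V | W ≤ E.toSubmodule ∧ W ≠ ⊥ ∧ ∀ g, ∀ v ∈ W, ρ g v ∈ W}
    ⟨E.toSubmodule, le_rfl, hE, fun g v hv => E.apply_mem_toSubmodule g hv⟩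
  refine ⟨⟨W, fun g v hv => hWinv g v hv⟩, hWE, ?_⟩
  set σ : Subrepresentation ρ := ⟨W, fun g v hv => hWinv g v hv⟩
  have hbt : (⊥ : Subrepresentation σ.toRepresentation) ≠ ⊤ := by
    intro h
    have h' : (⊥ : Submodule ℂ W) = ⊤ := congrArg Subrepresentation.toSubmodule h
    apply hW0
    have := congrArg (Submodule.map W.subtype) h'
    simpa using this.symm
  refine { exists_pair_ne := ⟨⊥, ⊤, hbt⟩, eq_bot_or_eq_top := fun τ => ?_ }
  by_cases hτ : τ.toSubmodule = ⊥
  · left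
    exact Subrepresentation.toSubmodule_injective hτ
  · right
    apply Subrepresentation.toSubmodule_injective
    have hle : Submodule.map W.subtype τ.toSubmodule ≤ W := Submodule.map_subtype_le W _
    have hnlt := hmin (Submodule.map W.subtype τ.toSubmodule) ⟨hle.trans hWE, ?_, ?_⟩
    · have heq : Submodule.map W.subtype τ.toSubmodule = W := by
        by_contra hne
        exact hnlt (lt_of_le_of_ne hle hne)
      change τ.toSubmodule = (⊤ : Submodule ℂ W)
      apply Submodule.map_injective_of_injective W.injective_subtype
      rw [heq]; simp
    · intro h
      apply hτ
      exact (Submodule.map_injective_of_injective W.injective_subtype) (by rw [h, Submodule.map_bot])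
    · rintro g _ ⟨w, hw, rfl⟩
      exact ⟨_, τ.apply_mem_toSubmodule g hw, rfl⟩

/-- An irreducible representation of a finite group gives a simple object of `FDRep`. -/
theorem FDRep.simple_of_isIrreducible {G V : Type} [Group G] [Finite G] [AddCommGroup V]
    [Module ℂ V] [FiniteDimensional ℂ V] (ρ : Representation ℂ G V) [ρ.IsIrreducible] :
    CategoryTheory.Simple (FDRep.of ρ) := by
  have := Fintype.ofFinite G
  have : Invertible (Nat.card G : ℂ) := invertibleOfNonzero (by simp)
  rw [FDRep.simple_iff_char_is_norm_one]
  have h := Representation.char_orthonormal ρ ρ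
  rw [if_pos ⟨Representation.Equiv.refl ρ⟩] at h
  rw [inv_mul_eq_one₀ (by simp)] at h
  exact h.symm

/-- A nonzero subrepresentation without invariant vectors has dimension at least the minimal degree
of a nontrivial irreducible character. -/
theorem le_finrank_of_no_invariants {G : Type} [Group G] [Finite G] {k : ℝ}
    (hk : k ∈ lowerBounds {d : ℝ | ∃ χ ∈ IrrChar G, χ ≠ (fun _ => 1) ∧ χ 1 = (d : ℂ)})
    {V : Type} [AddCommGroup V] [Module ℂ V] [FiniteDimensional ℂ V] {ρ : Representation ℂ G V}
    (E : Subrepresentation ρ) (hE : E.toSubmodule ≠ ⊥)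
    (hinv : ∀ v ∈ E.toSubmodule, (∀ g, ρ g v = v) → v = 0) :
    k ≤ Module.finrank ℂ E.toSubmodule := by
  have := Fintype.ofFinite G
  have : Invertible (Nat.card G : ℂ) := invertibleOfNonzero (by simp)
  obtain ⟨σ, hσE, hσ⟩ := E.exists_le_isIrreducible hE
  have hs := FDRep.simple_of_isIrreducible σ.toRepresentation
  have hle : k ≤ Module.finrank ℂ σ.toSubmodule := by
    refine hk ⟨(FDRep.of σ.toRepresentation).character, ⟨_, hs, rfl⟩, fun h => ?_, ?_⟩
    · have h1 := FDRep.average_char_eq_finrank_invariants (FDRep.of σ.toRepresentation)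
      have h0 : Module.finrank ℂ
          (Representation.invariants (FDRep.of σ.toRepresentation).ρ) = 0 := by
        rw [Submodule.finrank_eq_zero, Submodule.eq_bot_iff]
        intro v hv
        rw [Representation.mem_invariants] at hv
        exact Subtype.ext (hinv _ (hσE v.2) fun g => congrArg Subtype.val (hv g))
      rw [h0, h] at h1
      simp at h1
    · rw [FDRep.char_one]
      simp
  exact hle.trans (by exact_mod_cast Submodule.finrank_mono hσE)

/-- The degree of an irreducible character is positive. -/
theorem IrrChar.degree_pos {G : Type} [Group G] [Finite G] {χ : G → ℂ} (hχ : χ ∈ IrrChar G)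
    {d : ℝ} (hd : χ 1 = d) : 0 < d := by
  have := Fintype.ofFinite G
  obtain ⟨V, hV, rfl⟩ := hχ
  rw [FDRep.char_one] at hd
  have hd' : (Module.finrank ℂ V : ℝ) = d := by exact_mod_cast hd
  rw [← hd', Nat.cast_pos, Nat.pos_iff_ne_zero]
  intro h0
  have h := (FDRep.simple_iff_char_is_norm_one V).1 hV
  have : Subsingleton V := Module.finrank_zero_iff.1 h0
  have hz : ∀ g, V.character g = 0 := fun g => by
    have : V.ρ g = 0 := Subsingleton.elim _ _
    simp [FDRep.character, this]
  simp only [hz, mul_zero, Finset.sum_const_zero] at h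
  exact Nat.cast_ne_zero.2 Nat.card_pos.ne' h.symm

/-- The representation of `G` on functions by right translation. -/
def rightTranslation (G : Type*) [Group G] : Representation ℂ G (G → ℂ) where
  toFun g := LinearMap.funLeft ℂ ℂ (· * g)
  map_one' := by ext; simp [LinearMap.funLeft]
  map_mul' x y := by ext; simp [LinearMap.funLeft, mul_assoc]

theorem rightTranslation_apply {G : Type*} [Group G] (g : G) (v : G → ℂ) (x : G) :
    rightTranslation G g v x = v (x * g) := rfl

open Matrix ComplexOrder in
/-- For a positive semidefinite matrix, an eigenvalue times the dimension of its eigenspace is at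
most the trace. -/
theorem Matrix.PosSemidef.mul_finrank_eigenspace_le_trace {n : Type*} [Fintype n] [DecidableEq n]
    {H : Matrix n n ℂ} (hH : H.PosSemidef) (c : ℝ) (hc : 0 ≤ c) :
    c * Module.finrank ℂ (Module.End.eigenspace (toLin' H) (c : ℂ)) ≤ H.trace.re := by
  set I := Finset.univ.filter fun i => hH.1.eigenvalues i = c with hI
  have hle : Module.finrank ℂ (Module.End.eigenspace (toLin' H) (c : ℂ)) ≤ I.card := by
    let b := hH.1.eigenvectorBasis
    let L : (n → ℂ) →ₗ[ℂ] (I → ℂ) := LinearMap.pi fun i =>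
      (LinearMap.proj (i : n)).comp ((WithLp.linearEquiv 2 ℂ (n → ℂ)).toLinearMap.comp
        (b.repr.toLinearEquiv.toLinearMap.comp (WithLp.linearEquiv 2 ℂ (n → ℂ)).symm.toLinearMap))
    have hL : ∀ v i, L v i = b.repr (WithLp.toLp 2 v) i := fun v i => rfl
    have hinj : Function.Injective
        (L.domRestrict (Module.End.eigenspace (toLin' H) (c : ℂ))) := by
      rw [← LinearMap.ker_eq_bot, LinearMap.ker_eq_bot']
      rintro ⟨v, hv⟩ h0
      rw [Module.End.mem_eigenspace_iff, toLin'_apply] at hv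
      have hrepr : b.repr (WithLp.toLp 2 v) = 0 := by
        ext i
        by_cases hi : i ∈ I
        · exact congrFun h0 ⟨i, hi⟩
        · have hne : hH.1.eigenvalues i ≠ c := by simpa [hI] using hi
          have h1 : star (b i).ofLp ⬝ᵥ H *ᵥ v = hH.1.eigenvalues i * (star (b i).ofLp ⬝ᵥ v) := by
            rw [dotProduct_mulVec]
            nth_rw 1 [← hH.1.eq]
            rw [← star_mulVec, hH.1.mulVec_eigenvectorBasis i, star_smul, smul_dotProduct]
            simp [b]
          rw [hv, dotProduct_smul, smul_eq_mul] at h1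
          have h2 : ((c : ℂ) - hH.1.eigenvalues i) * (star (b i).ofLp ⬝ᵥ v) = 0 := by
            linear_combination h1
          have h3 := (mul_eq_zero.1 h2).resolve_left
            (sub_ne_zero.2 (by exact_mod_cast hne.symm))
          rw [OrthonormalBasis.repr_apply_apply, EuclideanSpace.inner_eq_star_dotProduct,
            dotProduct_comm]
          exact h3
      have hv0 := (LinearIsometryEquiv.map_eq_zero_iff b.repr).1 hrepr
      exact Subtype.ext (congrArg WithLp.ofLp hv0)
    simpa using LinearMap.finrank_le_finrank_of_injective hinj
  have htr : H.trace.re = ∑ i, hH.1.eigenvalues i := by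
    rw [hH.1.trace_eq_sum_eigenvalues]; simp
  rw [htr]
  calc c * Module.finrank ℂ (Module.End.eigenspace (toLin' H) (c : ℂ)) ≤ c * I.card := by gcongr
    _ = ∑ i ∈ I, hH.1.eigenvalues i := by
      rw [Finset.sum_congr rfl fun i hi => (Finset.mem_filter.1 hi).2]
      rw [Finset.sum_const, nsmul_eq_mul, mul_comm]
    _ ≤ _ := Finset.sum_le_univ_sum_of_nonneg fun i => hH.eigenvalues_nonneg i

open Matrix ComplexOrder in
/-- Eigenvalues of a right-invariant positive semidefinite matrix that kills constants. -/
theorem eigenvalue_mul_le_trace {G : Type} [Group G] [Fintype G] [DecidableEq G] {k : ℝ}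
    (hk : k ∈ lowerBounds {d : ℝ | ∃ χ ∈ IrrChar G, χ ≠ (fun _ => 1) ∧ χ 1 = (d : ℂ)})
    (hk0 : 0 ≤ k) {H : Matrix G G ℂ} (hH : H.PosSemidef)
    (hinv : ∀ g x y, H (x * g) (y * g) = H x y) (hone : H *ᵥ 1 = 0)
    {c : ℝ} {w : G → ℂ} (hw : w ≠ 0) (hHw : H *ᵥ w = (c : ℂ) • w) :
    c * k ≤ H.trace.re := by
  have htr : 0 ≤ H.trace.re := (Complex.le_def.1 hH.trace_nonneg).1
  rcases le_or_gt c 0 with hc | hc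
  · exact (mul_nonpos_of_nonpos_of_nonneg hc hk0).trans htr
  let E : Subrepresentation (rightTranslation G) :=
    ⟨Module.End.eigenspace (toLin' H) (c : ℂ), fun g v hv => by
      rw [Module.End.mem_eigenspace_iff, toLin'_apply] at hv ⊢
      ext x
      have := congrFun hv (x * g)
      simp only [mulVec, dotProduct, Pi.smul_apply, rightTranslation_apply] at this ⊢
      rw [← this, ← Equiv.sum_comp (Equiv.mulRight g) fun y => H (x * g) y * v y]
      simp [hinv]⟩
  refine le_trans ?_ (hH.mul_finrank_eigenspace_le_trace c hc.le)
  refine mul_le_mul_of_nonneg_left (le_finrank_of_no_invariants hk E ?_ ?_) hc.le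
  · intro h
    apply hw
    have : w ∈ E.toSubmodule := by
      rw [Module.End.mem_eigenspace_iff, toLin'_apply, hHw]
    simpa [h] using this
  · intro v hv hfix
    rw [Module.End.mem_eigenspace_iff, toLin'_apply] at hv
    have hconst : v = v 1 • (1 : G → ℂ) := by
      ext x
      have := congrFun (hfix x) 1
      simpa [rightTranslation_apply] using this
    rw [hconst, mulVec_smul, hone, smul_zero, ← hconst] at hv
    exact (smul_eq_zero.1 hv.symm).resolve_left (by exact_mod_cast hc.ne')

open Matrix ComplexOrder in
/-- The quadratic form of a right-invariant positive semidefinite matrix that kills constants. -/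
theorem quadraticForm_mul_le_trace {G : Type} [Group G] [Fintype G] [DecidableEq G] {k : ℝ}
    (hk : k ∈ lowerBounds {d : ℝ | ∃ χ ∈ IrrChar G, χ ≠ (fun _ => 1) ∧ χ 1 = (d : ℂ)})
    (hk0 : 0 < k) {H : Matrix G G ℂ} (hH : H.PosSemidef)
    (hinv : ∀ g x y, H (x * g) (y * g) = H x y) (hone : H *ᵥ 1 = 0) (v : G → ℂ) :
    (star v ⬝ᵥ H *ᵥ v).re ≤ H.trace.re / k * (star v ⬝ᵥ v).re := by
  set c : ℝ := H.trace.re / k with hc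
  have hherm : ((c : ℂ) • (1 : Matrix G G ℂ) - H).IsHermitian := by
    refine IsHermitian.sub ?_ hH.1
    simp [IsHermitian, conjTranspose_smul]
  have hpos : ((c : ℂ) • (1 : Matrix G G ℂ) - H).PosSemidef := by
    rw [hherm.posSemidef_iff_eigenvalues_nonneg]
    intro i
    have hev := hherm.mulVec_eigenvectorBasis i
    set w : G → ℂ := ⇑(hherm.eigenvectorBasis i) with hwdef
    have hw : w ≠ 0 := by
      intro h
      apply hherm.eigenvectorBasis.orthonormal.ne_zero i
      ext x
      exact congrFun h x
    have hHw : H *ᵥ w = ((c - hherm.eigenvalues i : ℝ) : ℂ) • w := by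
      rw [sub_mulVec, smul_mulVec, one_mulVec] at hev
      ext x
      have := congrFun hev x
      simp only [Pi.sub_apply, Pi.smul_apply, smul_eq_mul, Complex.real_smul] at this ⊢
      push_cast
      linear_combination -this
    have := eigenvalue_mul_le_trace hk hk0.le hH hinv hone hw hHw
    rw [← le_div_iff₀ hk0, ← hc] at this
    simpa using this
  have := (Complex.le_def.1 (hpos.dotProduct_mulVec_nonneg v)).1
  rw [sub_mulVec, smul_mulVec, one_mulVec, dotProduct_sub, dotProduct_smul] at this
  simpa using this

open Matrix ComplexOrder in
/-- Convolution with a real function of mean zero contracts the `ℓ²` norm. -/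
theorem sum_sq_convolution_le {G : Type} [Group G] [Fintype G] [DecidableEq G] {k : ℝ}
    (hk : k ∈ lowerBounds {d : ℝ | ∃ χ ∈ IrrChar G, χ ≠ (fun _ => 1) ∧ χ 1 = (d : ℂ)})
    (hk0 : 0 < k) (f u : G → ℝ) (hf : ∑ x, f x = 0) :
    ∑ x, (∑ y, f (x * y⁻¹) * u y) ^ 2
      ≤ Fintype.card G * (∑ x, f x ^ 2) / k * ∑ y, u y ^ 2 := by
  let M : Matrix G G ℂ := Matrix.of fun x y => (f (x * y⁻¹) : ℂ)
  have hrow : ∀ (h : G → ℝ) (x : G), ∑ y, h (x * y⁻¹) = ∑ y, h y := fun h x =>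
    Fintype.sum_equiv ((Equiv.inv G).trans (Equiv.mulLeft x)) _ _ fun y => by simp
  have hcol : ∀ (h : G → ℝ) (y : G), ∑ x, h (x * y⁻¹) = ∑ x, h x := fun h y =>
    Fintype.sum_equiv (Equiv.mulRight y⁻¹) _ _ fun x => by simp
  have hone : (Mᴴ * M) *ᵥ 1 = 0 := by
    have : M *ᵥ 1 = 0 := by
      ext x
      simp only [M, mulVec, dotProduct, of_apply, Pi.one_apply, mul_one, Pi.zero_apply]
      rw [← Complex.ofReal_sum, hrow, hf, Complex.ofReal_zero]
    rw [← mulVec_mulVec, this, mulVec_zero]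
  have hinv : ∀ g x y, (Mᴴ * M) (x * g) (y * g) = (Mᴴ * M) x y := by
    intro g x y
    simp only [M, mul_apply, conjTranspose_apply, of_apply]
    rw [← Equiv.sum_comp (Equiv.mulRight g)]
    simp [mul_assoc]
  have key := quadraticForm_mul_le_trace hk hk0 (posSemidef_conjTranspose_mul_self M) hinv hone
    fun y => (u y : ℂ)
  have htr : (Mᴴ * M).trace.re = Fintype.card G * ∑ x, f x ^ 2 := by
    simp only [M, trace, diag_apply, mul_apply, conjTranspose_apply, of_apply, Complex.star_def,
      Complex.conj_ofReal, ← Complex.ofReal_pow, ← Complex.ofReal_sum,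
      Complex.ofReal_re, ← sq]
    simp [hcol fun x => f x ^ 2]
  have hlhs : (star (fun y => (u y : ℂ)) ⬝ᵥ (Mᴴ * M) *ᵥ fun y => (u y : ℂ)).re
      = ∑ x, (∑ y, f (x * y⁻¹) * u y) ^ 2 := by
    rw [← mulVec_mulVec, dotProduct_mulVec, ← star_mulVec]
    simp only [M, dotProduct, mulVec, Pi.star_apply, of_apply, Complex.star_def,
      Complex.conj_ofReal, ← Complex.ofReal_pow, ← Complex.ofReal_mul, ← Complex.ofReal_sum,
      Complex.ofReal_re, ← sq]
  have hrhs : (star (fun y => (u y : ℂ)) ⬝ᵥ fun y => (u y : ℂ)).re = ∑ y, u y ^ 2 := by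
    simp only [dotProduct, Pi.star_apply, Complex.star_def,
      Complex.conj_ofReal, ← Complex.ofReal_pow, ← Complex.ofReal_sum,
      Complex.ofReal_re, ← sq]
  rwa [htr, hlhs, hrhs] at key

/-- `Ncard` as a sum of values of the convolution of two indicator functions. -/
theorem Ncard_eq_sum {G : Type} [Group G] [Fintype G] [DecidableEq G] (A B C : Finset G) :
    (Ncard A B C : ℝ) =
      ∑ x ∈ C, ∑ y, (if x * y⁻¹ ∈ A then 1 else 0) * (if y ∈ B then 1 else 0) := by
  have h : Ncard A B C =
      ((C ×ˢ Finset.univ).filter fun p : G × G => p.1 * p.2⁻¹ ∈ A ∧ p.2 ∈ B).card :=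
    Finset.card_bij' (fun p _ => (p.1 * p.2, p.2)) (fun p _ => (p.1 * p.2⁻¹, p.2))
      (by simp; tauto) (by simp; tauto) (by simp) (by simp)
  rw [h, Finset.card_filter, Finset.sum_product]
  push_cast
  simp only [ite_and, ite_mul, one_mul, zero_mul]

/-- The number of solutions of `a * b ∈ C` is close to its expected value. -/
theorem sq_Ncard_sub_le {G : Type} [Group G] [Fintype G] [DecidableEq G] {k : ℝ}
    (hk : k ∈ lowerBounds {d : ℝ | ∃ χ ∈ IrrChar G, χ ≠ (fun _ => 1) ∧ χ 1 = (d : ℂ)})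
    (hk0 : 0 < k) (A B C : Finset G) :
    ((Ncard A B C : ℝ) - A.card * B.card * C.card / Fintype.card G) ^ 2
      ≤ Fintype.card G * (A.card * B.card * C.card) / k := by
  have hn : (0 : ℝ) < Fintype.card G := by exact_mod_cast Fintype.card_pos
  set n : ℝ := (Fintype.card G : ℝ) with hndef
  let f : G → ℝ := fun x => (if x ∈ A then 1 else 0) - A.card / n
  let u : G → ℝ := fun y => if y ∈ B then 1 else 0
  have hf : ∑ x, f x = 0 := by
    simp [f, Finset.sum_sub_distrib, ← hndef]
    field_simp
    simp
  have hf2 : ∑ x, f x ^ 2 ≤ A.card := by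
    have h : ∀ x, f x ^ 2 = (if x ∈ A then 1 else 0) - A.card / n * (f x)
        - A.card / n * (if x ∈ A then 1 else 0) := by
      intro x
      simp only [f]
      split_ifs <;> ring
    simp_rw [h]
    rw [Finset.sum_sub_distrib, Finset.sum_sub_distrib, ← Finset.mul_sum, ← Finset.mul_sum, hf]
    simp
    positivity
  have hu : ∑ y, u y ^ 2 = B.card := by simp [u]
  have hN : (Ncard A B C : ℝ) - A.card * B.card * C.card / n
      = ∑ x ∈ C, ∑ y, f (x * y⁻¹) * u y := by
    simp only [Ncard_eq_sum, f, u, sub_mul, Finset.sum_sub_distrib, ← Finset.mul_sum]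
    simp
    ring
  have hconv := sum_sq_convolution_le hk hk0 f u hf
  rw [hu, ← hndef] at hconv
  rw [hN]
  calc (∑ x ∈ C, ∑ y, f (x * y⁻¹) * u y) ^ 2
      ≤ C.card * ∑ x ∈ C, (∑ y, f (x * y⁻¹) * u y) ^ 2 := sq_sum_le_card_mul_sum_sq
    _ ≤ C.card * ∑ x, (∑ y, f (x * y⁻¹) * u y) ^ 2 := by
      gcongr
      exact C.subset_univ
    _ ≤ C.card * (n * (∑ x, f x ^ 2) / k * B.card) := by gcongr
    _ ≤ C.card * (n * A.card / k * B.card) := by gcongr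
    _ = _ := by ring

theorem stmt6 {G : Type} [Group G] [Fintype G] [DecidableEq G]
    (A B C : Finset G) (hA : A.Nonempty) (hB : B.Nonempty) (hC : C.Nonempty)
    (k : ℝ)
    (hk : IsLeast {d : ℝ | ∃ χ ∈ IrrChar G, χ ≠ (fun _ => 1) ∧ χ 1 = (d : ℂ)} k)
    (η : ℝ) (hη : 0 < η)
    (hABC : (A.card : ℝ) * (B.card : ℝ) * (C.card : ℝ)
        > (Fintype.card G : ℝ) ^ 3 / (η ^ 2 * k)) :
    (1 - η) * ((C.card : ℝ) / (Fintype.card G : ℝ)) < prob A B C ∧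
    prob A B C < (1 + η) * ((C.card : ℝ) / (Fintype.card G : ℝ)) := by
  have hk0 : 0 < k := by
    obtain ⟨χ, hχ, -, hd⟩ := hk.1
    exact IrrChar.degree_pos hχ hd
  have key := sq_Ncard_sub_le hk.2 hk0 A B C
  have hn : (0 : ℝ) < Fintype.card G := by exact_mod_cast Fintype.card_pos
  have ha : (0 : ℝ) < A.card := by exact_mod_cast hA.card_pos
  have hb : (0 : ℝ) < B.card := by exact_mod_cast hB.card_pos
  have hc : (0 : ℝ) < C.card := by exact_mod_cast hC.card_pos
  unfold prob
  generalize (Fintype.card G : ℝ) = n at *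
  generalize (A.card : ℝ) = a at *
  generalize (B.card : ℝ) = b at *
  generalize (C.card : ℝ) = c at *
  generalize (Ncard A B C : ℝ) = N at *
  have hP : 0 < a * b * c := by positivity
  have hlt : (N - a * b * c / n) ^ 2 < (η * (a * b * c) / n) ^ 2 := by
    refine key.trans_lt ?_
    rw [gt_iff_lt, div_lt_iff₀ (by positivity)] at hABC
    rw [div_pow, div_lt_div_iff₀ hk0 (by positivity)]
    calc n * (a * b * c) * n ^ 2 = n ^ 3 * (a * b * c) := by ring
      _ < a * b * c * (η ^ 2 * k) * (a * b * c) := by gcongr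
      _ = _ := by ring
  obtain ⟨h1, h2⟩ := abs_lt.1 (abs_lt_of_sq_lt_sq hlt (by positivity))
  constructor
  · rw [lt_div_iff₀ (by positivity)]
    calc (1 - η) * (c / n) * (a * b) = a * b * c / n - η * (a * b * c) / n := by ring
      _ < N := by linarith
  · rw [div_lt_iff₀ (by positivity)]
    calc N < a * b * c / n + η * (a * b * c) / n := by linarith
      _ = _ := by ring
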